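/- arXiv:2004.10494 — 2 statements merged into one kernel-verified Lean document; each statement's English description precedes it below -/
import Mathlib

section
/- Let G be a finite solvable group with subgroups H and K that are isomorphic as abstract groups, where H is a maximal subgroup of G (so |G : H| = p^n for some prime p and positive integer n). If the p-length of G satisfies l_p(G) ≤ 1, then K is also a maximal subgroup of G. (Theorem 1.5) -/
/-- In a finite order in which any two distinct elements covered by a common element cover a
common element, the height increases by exactly one along a covering. -/
theorem Order.height_eq_add_one_of_covBy {α : Type*} [PartialOrder α] [Finite α]
    (h : ∀ a a' b : α, a ⋖ b → a' ⋖ b → a ≠ a' → ∃ c, c ⋖ a ∧ c ⋖ a')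
    {a b : α} (hab : a ⋖ b) : Order.height b = Order.height a + 1 := by
  induction b using WellFoundedLT.induction generalizing a with
  | ind b ih =>
    refine le_antisymm ?_ (Order.height_add_one_le hab.lt)
    rw [Order.height_eq_iSup_lt_height]
    refine iSup₂_le fun y hy => ?_
    obtain ⟨a', hya', ha'⟩ := exists_le_covBy_of_lt hy
    refine add_le_add_left ((Order.height_mono hya').trans ?_) 1
    rcases eq_or_ne a a' with rfl | hne
    · exact le_rfl
    · obtain ⟨c, hca, hca'⟩ := h a a' b hab ha' hne
      rw [ih a hab.lt hca, ih a' ha'.lt hca']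

theorem Order.height_ne_top_of_finite {α : Type*} [Preorder α] [Finite α] (a : α) :
    Order.height a ≠ ⊤ := by
  have := Fintype.ofFinite α
  have : Order.height a ≤ (Fintype.card α : ℕ∞) :=
    Order.height_le fun s _ => by exact_mod_cast s.length_lt_card.le
  exact (this.trans_lt (ENat.natCast_lt_top _)).ne

namespace Subgroup

variable {G : Type*} [Group G]

theorem le_normalizer_of_forall_conj_mem {Y D : Subgroup G}
    (h : ∀ y ∈ Y, ∀ d ∈ D, y * d * y⁻¹ ∈ D) : Y ≤ normalizer (D : Set G) := by
  intro y hy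
  rw [mem_normalizer_iff]
  refine fun d => ⟨h y hy d, fun hd => ?_⟩
  simpa [mul_assoc] using h y⁻¹ (inv_mem hy) _ hd

theorem le_normalizer_inf {Y A B : Subgroup G} (hA : Y ≤ normalizer (A : Set G))
    (hB : Y ≤ normalizer (B : Set G)) : Y ≤ normalizer ((A ⊓ B : Subgroup G) : Set G) :=
  le_normalizer_of_forall_conj_mem fun _ hy d hd =>
    ⟨(mem_normalizer_iff.1 (hA hy) d).1 hd.1, (mem_normalizer_iff.1 (hB hy) d).1 hd.2⟩

theorem le_normalizer_sup {Y A B : Subgroup G} (hA : Y ≤ normalizer (A : Set G))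
    (hB : Y ≤ normalizer (B : Set G)) : Y ≤ normalizer ((A ⊔ B : Subgroup G) : Set G) := by
  refine le_normalizer_of_forall_conj_mem fun y hy d hd => ?_
  have : A ⊔ B ≤ (A ⊔ B).comap (MulAut.conj y).toMonoidHom := by
    refine sup_le (fun a ha => ?_) fun b hb => ?_
    · exact mem_sup_left ((mem_normalizer_iff.1 (hA hy) a).1 ha)
    · exact mem_sup_right ((mem_normalizer_iff.1 (hB hy) b).1 hb)
  exact this hd

/-- The modular law for a join of two subgroups, one of which normalizes the other. -/
theorem inf_sup_le_of_le_normalizer {A B C : Subgroup G} (hB : B ≤ normalizer (C : Set G))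
    (hBA : B ≤ A) : A ⊓ (B ⊔ C) ≤ B ⊔ (A ⊓ C) := by
  rintro x ⟨hxA, hx⟩
  replace hx : x ∈ ((B ⊔ C : Subgroup G) : Set G) := hx
  rw [coe_mul_of_left_le_normalizer_right _ _ hB] at hx
  obtain ⟨b, hb, c, hc, rfl⟩ := hx
  refine mul_mem_sup hb ⟨?_, hc⟩
  exact (mul_mem_cancel_left (hBA hb)).1 hxA

theorem relIndex_sup_self_of_normal [Finite G] (Y N : Subgroup G) [N.Normal] :
    Y.relIndex (Y ⊔ N) = Y.relIndex N := by
  have h₁ := relIndex_mul_relIndex (Y ⊓ N) Y (Y ⊔ N) inf_le_left le_sup_left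
  have h₂ := relIndex_mul_relIndex (Y ⊓ N) N (Y ⊔ N) inf_le_right le_sup_right
  rw [relIndex_sup_right, inf_relIndex_right, ← h₁, inf_relIndex_left, mul_comm] at h₂
  refine (Nat.eq_of_mul_eq_mul_left (Nat.pos_of_ne_zero ?_) h₂).symm
  exact index_ne_zero_of_finite

theorem le_of_coprime_index [Finite G] {N Y : Subgroup G} [N.Normal]
    (h : (Nat.card N).Coprime Y.index) : N ≤ Y := by
  rw [← relIndex_eq_one]
  refine Nat.eq_one_of_dvd_coprimes h (relIndex_dvd_card Y N) ?_
  rw [← relIndex_sup_self_of_normal]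
  exact relIndex_dvd_index_of_le le_sup_left

theorem sup_eq_top_of_coprime_index {M Y : Subgroup G} (h : M.index.Coprime Y.index) :
    Y ⊔ M = ⊤ :=
  index_eq_one.1 <| Nat.eq_one_of_dvd_coprimes h (index_dvd_of_le le_sup_right)
    (index_dvd_of_le le_sup_left)

variable {p : ℕ} {N M : Subgroup G}

theorem isPGroup_map_mk' [N.Normal] (hMN : ∀ m ∈ M, ∃ k, m ^ p ^ k ∈ N) {E : Subgroup G}
    (hE : E ≤ M) : IsPGroup p (E.map (QuotientGroup.mk' N)) := by
  rintro ⟨_, x, hx, rfl⟩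
  obtain ⟨k, hk⟩ := hMN x (hE hx)
  refine ⟨k, Subtype.ext ?_⟩
  simpa using (QuotientGroup.eq_one_iff (N := N) (x ^ p ^ k)).2 hk

theorem exists_relIndex_eq_prime_pow [Finite G] [Fact p.Prime] [N.Normal]
    (hMN : ∀ m ∈ M, ∃ k, m ^ p ^ k ∈ N) {D E : Subgroup G} (hND : N ≤ D)
    (hDE : D ≤ E) (hE : E ≤ M) : ∃ k, D.relIndex E = p ^ k := by
  obtain ⟨k, hk⟩ := IsPGroup.iff_card.1 (isPGroup_map_mk' hMN hE)
  rw [← relIndex_ker, QuotientGroup.ker_mk'] at hk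
  have := Dvd.intro_left _ (relIndex_mul_relIndex N D E hND hDE)
  rw [hk, Nat.dvd_prime_pow Fact.out] at this
  exact ⟨_, this.choose_spec.2⟩

/-- The normalizer condition in a group `M` with a normal subgroup `N` such that `M / N` is a
`p`-group. -/
theorem exists_mem_normalizer_of_lt [Finite G] [Fact p.Prime] [N.Normal]
    (hMN : ∀ m ∈ M, ∃ k, m ^ p ^ k ∈ N) {D E : Subgroup G} (hND : N ≤ D)
    (hDE : D < E) (hE : E ≤ M) : ∃ x ∈ E, x ∉ D ∧ x ∈ normalizer (D : Set G) := by
  set π := QuotientGroup.mk' N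
  have hker : ∀ x, π x ∈ D.map π ↔ x ∈ D := fun x => by
    rw [← mem_comap, comap_map_eq, QuotientGroup.ker_mk', sup_eq_left.2 hND]
  have hnil : Group.IsNilpotent (E.map π) := (isPGroup_map_mk' hMN hE).isNilpotent
  have hlt : (D.map π).subgroupOf (E.map π) < ⊤ := by
    rw [lt_top_iff_ne_top, Ne, subgroupOf_eq_top]
    exact fun h => hDE.not_ge fun x hx => (hker x).1 (h (mem_map_of_mem π hx))
  obtain ⟨⟨_, x, hxE, rfl⟩, hx, hxD⟩ :=
    SetLike.exists_of_lt (Group.normalizerCondition_of_isNilpotent _ hlt)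
  refine ⟨x, hxE, fun h => hxD ((hker x).2 h), mem_normalizer_iff.2 fun d => ?_⟩
  have key : ∀ d ∈ E, (d ∈ D ↔ x * d * x⁻¹ ∈ D) := fun d hd => by
    simpa [mem_subgroupOf, hker, ← map_mul, ← map_inv] using
      mem_normalizer_iff.1 hx ⟨π d, mem_map_of_mem π hd⟩
  refine ⟨fun hd => (key d (hDE.le hd)).1 hd, fun hd => ?_⟩
  refine (key d ?_).2 hd
  simpa [mul_assoc] using mul_mem (mul_mem (inv_mem hxE) (hDE.le hd)) hxE

end Subgroup

theorem IsPGroup.inf_centralizer_ne_bot {Q : Type*} [Group Q] [Finite Q] {p : ℕ} [Fact p.Prime]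
    {P B : Subgroup Q} (hP : IsPGroup p P) [B.Normal] (hBP : B ≤ P) (hB : B ≠ ⊥) :
    B ⊓ Subgroup.centralizer P ≠ ⊥ := by
  let _ : MulAction P B := MulAction.compHom B ((MulAut.conjNormal (H := B)).comp P.subtype)
  have hsmul : ∀ (g : P) (b : B), ((g • b : B) : Q) = g * b * (g : Q)⁻¹ := fun g b =>
    MulAut.conjNormal_apply (H := B) (g : Q) b
  have hdvd : p ∣ Nat.card B := by
    have : Nontrivial B := (Subgroup.nontrivial_iff_ne_bot B).2 hB
    obtain ⟨n, hn0, hn⟩ := (hP.to_le hBP).nontrivial_iff_card.mp inferInstance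
    exact hn.symm ▸ dvd_pow_self _ hn0.ne'
  obtain ⟨b, hb, hb1⟩ := hP.exists_fixed_point_of_prime_dvd_card_of_fixed_point B hdvd (a := 1)
    (fun g => Subtype.ext (by rw [hsmul]; simp))
  intro h
  have : (b : Q) ∈ B ⊓ Subgroup.centralizer (P : Set Q) := by
    refine ⟨b.2, Subgroup.mem_centralizer_iff.2 fun g hg => ?_⟩
    have := congrArg Subtype.val (hb ⟨g, hg⟩)
    rw [hsmul] at this
    exact mul_inv_eq_iff_eq_mul.1 this
  rw [h, Subgroup.mem_bot] at this
  exact hb1 (Subtype.ext this.symm)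

namespace Subgroup

/-- In a nontrivial normal section `B / A` contained in a normal `p`-section `P / A`, the fixed
points of `P` form a nontrivial normal section. -/
theorem exists_normal_commutator_mem {X : Type*} [Group X] [Finite X] {p : ℕ} [Fact p.Prime]
    {A B P : Subgroup X} [A.Normal] [B.Normal] [P.Normal] (hAB : A < B) (hBP : B ≤ P)
    (hP : ∀ m ∈ P, ∃ k, m ^ p ^ k ∈ A) :
    ∃ C : Subgroup X, C.Normal ∧ A < C ∧ C ≤ B ∧
      ∀ m ∈ P, ∀ c ∈ C, m * c * m⁻¹ * c⁻¹ ∈ A := by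
  set π := QuotientGroup.mk' A with hπ
  have hsurj : Function.Surjective π := QuotientGroup.mk'_surjective A
  have hker : ∀ x, π x = 1 ↔ x ∈ A := fun x => QuotientGroup.eq_one_iff x
  have : (B.map π).Normal := Normal.map inferInstance π hsurj
  have : (P.map π).Normal := Normal.map inferInstance π hsurj
  have hB : B.map π ≠ ⊥ := by
    rw [Ne, map_eq_bot_iff, QuotientGroup.ker_mk']
    exact hAB.not_ge
  have hne := (isPGroup_map_mk' hP le_rfl).inf_centralizer_ne_bot (map_mono hBP) hB
  obtain ⟨⟨z, hz⟩, hz1⟩ := ne_bot_iff_exists_ne_one.1 hne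
  replace hz1 : z ≠ 1 := fun h => hz1 (Subtype.ext h)
  obtain ⟨x, rfl⟩ := hsurj z
  have hcomap : (B.map π).comap π = B := by
    rw [comap_map_eq, QuotientGroup.ker_mk', sup_eq_left.2 hAB.le]
  refine ⟨(B.map π ⊓ centralizer (P.map π)).comap π, inferInstance, ?_, ?_, ?_⟩
  · refine lt_of_le_of_ne (fun a ha => ?_) fun h => ?_
    · rw [mem_comap, (hker a).2 ha]
      exact one_mem _
    · refine hz1 ((hker x).2 ?_)
      rw [h]
      exact hz
  · exact (comap_mono inf_le_left).trans hcomap.le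
  · rintro m hm c ⟨-, hc⟩
    rw [← hker, map_mul, map_mul, map_mul, map_inv, map_inv,
      mem_centralizer_iff.1 hc (π m) (mem_map_of_mem π hm)]
    simp

theorem exists_le_normalizer_commutator_mem {G : Type*} [Group G] [Finite G] {p : ℕ}
    [Fact p.Prime] {N M L A B : Subgroup G} [M.Normal] (hMN : ∀ m ∈ M, ∃ k, m ^ p ^ k ∈ N)
    (hNA : N ≤ A) (hAB : A < B) (hB : B ≤ M ⊓ L) (hLA : L ≤ normalizer (A : Set G))
    (hLB : L ≤ normalizer (B : Set G)) :
    ∃ C : Subgroup G, A < C ∧ C ≤ B ∧ L ≤ normalizer (C : Set G) ∧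
      ∀ m ∈ M ⊓ L, ∀ c ∈ C, m * c * m⁻¹ * c⁻¹ ∈ A := by
  have hBL : B ≤ L := hB.trans inf_le_right
  have : (A.subgroupOf L).Normal := (normal_subgroupOf_iff_le_normalizer (hAB.le.trans hBL)).2 hLA
  have : (B.subgroupOf L).Normal := (normal_subgroupOf_iff_le_normalizer hBL).2 hLB
  have hlt : A.subgroupOf L < B.subgroupOf L := by
    refine lt_of_le_not_ge (comap_mono hAB.le) fun h => hAB.not_ge fun b hb => ?_
    exact h (show (⟨b, hBL hb⟩ : L) ∈ B.subgroupOf L from hb)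
  obtain ⟨C, hC, hAC, hCB, hcomm⟩ := exists_normal_commutator_mem (p := p) (P := M.subgroupOf L)
    hlt (comap_mono (hB.trans inf_le_left)) fun m hm =>
      (hMN m hm).imp fun k hk => hNA hk
  refine ⟨C.map L.subtype, ?_, ?_, ?_, ?_⟩
  · rw [← map_subgroupOf_eq_of_le (hAB.le.trans hBL)]
    exact (map_lt_map_iff_of_injective L.subtype_injective).2 hAC
  · rw [← map_subgroupOf_eq_of_le hBL]
    exact map_mono hCB
  · refine le_normalizer_of_forall_conj_mem ?_
    rintro y hy _ ⟨c, hc, rfl⟩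
    exact ⟨⟨y, hy⟩ * c * ⟨y, hy⟩⁻¹, hC.conj_mem c hc _, rfl⟩
  · rintro m ⟨hmM, hmL⟩ _ ⟨c, hc, rfl⟩
    exact hcomm ⟨m, hmL⟩ hmM c hc

end Subgroup

namespace Subgroup

section InvariantBetween

variable {G : Type*} [Group G] {N M : Subgroup G}

/-- The subgroups between `N` and `M ⊓ Y` that are normalized by `Y`. -/
abbrev InvariantBetween (N M Y : Subgroup G) : Type _ :=
  {D : Subgroup G // N ≤ D ∧ D ≤ M ⊓ Y ∧ Y ≤ normalizer (D : Set G)}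

/-- The largest element of `InvariantBetween N M Y`. -/
def InvariantBetween.top [M.Normal] (hNM : N ≤ M) {Y : Subgroup G} (hNY : N ≤ Y) :
    InvariantBetween N M Y :=
  ⟨M ⊓ Y, le_inf hNM hNY, le_rfl, le_normalizer_inf le_normalizer_of_normal le_normalizer⟩

theorem InvariantBetween.exists_covBy {Y : Subgroup G} {a a' b : InvariantBetween N M Y}
    (ha : a ⋖ b) (ha' : a' ⋖ b) (hne : a ≠ a') : ∃ c, c ⋖ a ∧ c ⋖ a' := by
  have hc : N ≤ a.1 ⊓ a'.1 ∧ a.1 ⊓ a'.1 ≤ M ⊓ Y ∧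
      Y ≤ normalizer ((a.1 ⊓ a'.1 : Subgroup G) : Set G) :=
    ⟨le_inf a.2.1 a'.2.1, inf_le_left.trans a.2.2.1, le_normalizer_inf a.2.2.2 a'.2.2.2⟩
  have key : ∀ {d d' : InvariantBetween N M Y} (h : N ≤ d.1 ⊓ d'.1 ∧ d.1 ⊓ d'.1 ≤ M ⊓ Y ∧
      Y ≤ normalizer ((d.1 ⊓ d'.1 : Subgroup G) : Set G)), d ⋖ b → d' ⋖ b → d ≠ d' →
      (⟨d.1 ⊓ d'.1, h⟩ : InvariantBetween N M Y) ⋖ d := by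
    intro d d' h hd hd' hdd'
    refine ⟨lt_of_le_not_ge (Subtype.mk_le_mk.2 inf_le_left) fun hle => ?_, fun x hcx hxd => ?_⟩
    · have hdd : d.1 ≤ d'.1 := (show d.1 ≤ d.1 ⊓ d'.1 from hle).trans inf_le_right
      exact hd.2 (lt_of_le_of_ne (show d ≤ d' from hdd) hdd') hd'.lt
    · let s : InvariantBetween N M Y := ⟨x.1 ⊔ d'.1, x.2.1.trans le_sup_left,
        sup_le x.2.2.1 d'.2.2.1, le_normalizer_sup x.2.2.2 d'.2.2.2⟩
      have hsb : s ≤ b := sup_le (show x.1 ≤ b.1 from hxd.le.trans hd.le)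
        (show d'.1 ≤ b.1 from hd'.le)
      have hd's : d' ≤ s := le_sup_right (a := x.1)
      rcases hd'.eq_or_eq hd's hsb with hs | hs
      · have hxd' : x.1 ≤ d'.1 := by
          rw [← hs]
          exact le_sup_left
        exact hcx.not_ge (le_inf hxd.le hxd')
      · have hxY : x.1 ≤ normalizer (d'.1 : Set G) :=
          (x.2.2.1.trans inf_le_right).trans d'.2.2.2
        have hds : d.1 ≤ x.1 ⊔ d'.1 := hd.le.trans hs.ge
        refine hxd.not_ge ?_
        exact (le_inf le_rfl hds).trans
          ((inf_sup_le_of_le_normalizer hxY hxd.le).trans (sup_le le_rfl hcx.le))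
  refine ⟨⟨_, hc⟩, key hc ha ha' hne, ?_⟩
  have hc' := hc
  rw [inf_comm] at hc'
  have := key hc' ha' ha hne.symm
  convert this using 2
  exact inf_comm _ _

theorem InvariantBetween.height_eq_add_one [Finite G] {Y : Subgroup G}
    {a b : InvariantBetween N M Y} (h : a ⋖ b) : Order.height b = Order.height a + 1 :=
  Order.height_eq_add_one_of_covBy (fun _ _ _ => exists_covBy) h

variable {p : ℕ}

theorem InvariantBetween.height_top_le_of_mulEquiv [Finite G] [hp : Fact p.Prime] [N.Normal]
    [M.Normal] (hNM : N ≤ M) (hN : (Nat.card N).Coprime p) (hM : M.index.Coprime p)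
    (hMN : ∀ m ∈ M, ∃ k, m ^ p ^ k ∈ N) {H K : Subgroup G} (hNH : N ≤ H) (hNK : N ≤ K)
    (e : H ≃* K) :
    Order.height (top (M := M) hNM hNH) ≤ Order.height (top (M := M) hNM hNK) := by
  set φ : H →* G := K.subtype.comp e.toMonoidHom with hφ
  have hφinj : Function.Injective φ := K.subtype_injective.comp e.injective
  have hφK : ∀ x, φ x ∈ K := fun x => (e x).2
  let ψ : Subgroup G → Subgroup G := fun D => (D.subgroupOf H).map φ
  have hψmono : Monotone ψ := fun _ _ h => map_mono (comap_mono h)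
  let f : InvariantBetween N M H → InvariantBetween N M K := fun D =>
    ⟨N ⊔ (M ⊓ ψ D.1), le_sup_left, by
      refine sup_le (le_inf hNM hNK) (inf_le_inf_left M ?_)
      rintro _ ⟨x, -, rfl⟩
      exact hφK x, by
      refine le_normalizer_sup le_normalizer_of_normal
        (le_normalizer_inf le_normalizer_of_normal ?_)
      refine le_normalizer_of_forall_conj_mem ?_
      rintro y hy _ ⟨x, hx, rfl⟩
      obtain ⟨h, hh⟩ := e.surjective ⟨y, hy⟩
      have hφh : φ h = y := congrArg Subtype.val hh
      refine ⟨h * x * h⁻¹, ?_, by rw [map_mul, map_mul, map_inv, hφh]⟩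
      exact (mem_normalizer_iff.1 (D.2.2.2 h.2) x).1 hx⟩
  have hf : StrictMono f := by
    intro D D' hlt
    refine lt_of_le_not_ge (sup_le_sup_left (inf_le_inf_left M (hψmono hlt.le)) N) fun hge => ?_
    have hD'H : D'.1 ≤ H := D'.2.2.1.trans inf_le_right
    have hrel : (ψ D.1).relIndex (ψ D'.1) = D.1.relIndex D'.1 := by
      rw [relIndex_map_map_of_injective _ _ hφinj, relIndex_subgroupOf hD'H]
    obtain ⟨k, hk⟩ := exists_relIndex_eq_prime_pow hMN D.2.1 hlt.le (D'.2.2.1.trans inf_le_left)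
    have hk0 : k ≠ 0 := by
      rintro rfl
      rw [pow_zero, relIndex_eq_one] at hk
      exact hlt.not_ge hk
    have hp1 : p ∣ (M ⊓ ψ D.1).relIndex (ψ D'.1) := by
      rw [← relIndex_mul_relIndex _ (ψ D.1) (ψ D'.1) inf_le_right (hψmono hlt.le), hrel, hk]
      exact (dvd_pow_self p hk0).mul_left _
    rw [← relIndex_mul_relIndex _ (M ⊓ ψ D'.1) (ψ D'.1)
      (inf_le_inf_left M (hψmono hlt.le)) inf_le_right, inf_relIndex_right] at hp1
    have hp2 : p ∣ (M ⊓ ψ D.1).relIndex (M ⊓ ψ D'.1) :=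
      (Nat.Coprime.coprime_dvd_left (relIndex_dvd_index_of_normal M _) hM).symm.dvd_of_dvd_mul_right
        hp1
    have hle : M ⊓ ψ D'.1 ≤ M ⊓ ψ D.1 ⊔ N := by
      rw [sup_comm]
      exact le_sup_right.trans hge
    have hp3 : p ∣ (M ⊓ ψ D.1).relIndex N := by
      rw [← relIndex_sup_self_of_normal]
      exact hp2.trans (Dvd.intro _ (relIndex_mul_relIndex _ _ _
        (inf_le_inf_left M (hψmono hlt.le)) hle))
    exact hp.out.one_lt.ne' (Nat.eq_one_of_dvd_coprimes hN
      (hp3.trans (relIndex_dvd_card _ _)) dvd_rfl)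
  refine (Order.height_le_height_apply_of_strictMono f hf _).trans (Order.height_mono ?_)
  exact (f _).2.2.1

theorem InvariantBetween.height_eq_height [Finite G] [Fact p.Prime] [N.Normal] [M.Normal]
    (hMN : ∀ m ∈ M, ∃ k, m ^ p ^ k ∈ N) {K L : Subgroup G} (hKL : K ≤ L) (hL : L ≤ K ⊔ M ⊓ L)
    (D : InvariantBetween N M L) (hDK : D.1 ≤ K) :
    Order.height D = Order.height
      (⟨D.1, D.2.1, le_inf (D.2.2.1.trans inf_le_left) hDK, hKL.trans D.2.2.2⟩ :
        InvariantBetween N M K) := by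
  induction D using WellFoundedLT.induction with
  | ind D ih =>
    by_cases hD : D.1 = N
    · rw [Order.height_eq_zero.2, Order.height_eq_zero.2]
      · exact fun x _ => hD.le.trans x.2.1
      · exact fun x _ => hD.le.trans x.2.1
    · let n : InvariantBetween N M L := ⟨N, le_rfl, D.2.1.trans D.2.2.1, le_normalizer_of_normal⟩
      have hn : n < D := lt_of_le_of_ne D.2.1 fun h => hD (congrArg Subtype.val h).symm
      obtain ⟨C, -, hC⟩ := exists_le_covBy_of_lt hn
      rw [height_eq_add_one hC, ih C hC.lt ((show C.1 ≤ D.1 from hC.le).trans hDK)]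
      symm
      refine height_eq_add_one ⟨hC.lt, fun E hCE hED => ?_⟩
      obtain ⟨Z, hCZ, hZD, hLZ, hcomm⟩ := exists_le_normalizer_commutator_mem hMN C.2.1 hC.lt
        D.2.2.1 C.2.2.2 D.2.2.2
      have hZ : Z = D.1 := by
        by_contra hne
        exact hC.2 (c := ⟨Z, C.2.1.trans hCZ.le, hZD.trans D.2.2.1, hLZ⟩) hCZ
          ((show Z ≤ D.1 from hZD).lt_of_ne hne)
      subst hZ
      have hLE : L ≤ normalizer (E.1 : Set G) := by
        refine hL.trans (sup_le E.2.2.2 ?_)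
        refine le_normalizer_of_forall_conj_mem fun y hy d hd => ?_
        rw [← inv_mul_cancel_right (y * d * y⁻¹) d]
        exact mul_mem (hCE.le (hcomm y hy d (hED.le hd))) hd
      exact hC.2 (c := ⟨E.1, E.2.1, E.2.2.1.trans (inf_le_inf_left M hKL), hLE⟩) hCE hED

theorem InvariantBetween.height_top_of_covBy [Finite G] [Fact p.Prime] [N.Normal] [M.Normal]
    (hNM : N ≤ M) (hMN : ∀ m ∈ M, ∃ k, m ^ p ^ k ∈ N) {K L : Subgroup G} (hKL : K ⋖ L)
    (hNK : N ≤ K) (hNL : N ≤ L) (hKM : K ⊔ M = ⊤) :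
    Order.height (top (M := M) hNM hNL) = Order.height (top (M := M) hNM hNK) + 1 := by
  have hL : L ≤ K ⊔ M ⊓ L := by
    have := inf_sup_le_of_le_normalizer (A := L) (B := K) (C := M) le_normalizer_of_normal hKL.le
    rwa [hKM, inf_top_eq, inf_comm] at this
  have hML : ¬ M ⊓ L ≤ K := fun h => hKL.lt.not_ge (hL.trans (sup_le le_rfl h))
  have hlt : M ⊓ K < M ⊓ L :=
    lt_of_le_not_ge (inf_le_inf_left M hKL.le) fun h => hML (h.trans inf_le_right)
  have hnorm : L ≤ normalizer ((M ⊓ K : Subgroup G) : Set G) := by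
    obtain ⟨x, hx, hxK, hxn⟩ := exists_mem_normalizer_of_lt hMN (le_inf hNM hNK) hlt inf_le_left
    have hle : K ≤ L ⊓ normalizer ((M ⊓ K : Subgroup G) : Set G) :=
      le_inf hKL.le (le_normalizer_inf le_normalizer_of_normal le_normalizer)
    rcases hKL.eq_or_eq hle inf_le_left with h | h
    · have hxK' : x ∈ K := h.le ⟨hx.2, hxn⟩
      exact absurd ⟨hx.1, hxK'⟩ hxK
    · exact inf_eq_left.1 h
  let D : InvariantBetween N M L := ⟨M ⊓ K, le_inf hNM hNK, hlt.le, hnorm⟩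
  have hD : D ⋖ top hNM hNL := by
    refine ⟨hlt, fun E hDE hE => ?_⟩
    have hEM : E.1 ≤ M := E.2.2.1.trans inf_le_left
    have hEK : ¬ E.1 ≤ K := fun h => hDE.not_ge (le_inf hEM h)
    have hKE : K ⊔ E.1 = L :=
      (hKL.eq_or_eq le_sup_left (sup_le hKL.le (E.2.2.1.trans inf_le_right))).resolve_left
        fun h => hEK (le_sup_right.trans h.le)
    refine hE.not_ge (show M ⊓ L ≤ E.1 from ?_)
    rintro x ⟨hxM, hxL⟩
    replace hxL : x ∈ ((K ⊔ E.1 : Subgroup G) : Set G) := by rwa [hKE]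
    rw [coe_mul_of_left_le_normalizer_right _ _ (hKL.le.trans E.2.2.2)] at hxL
    obtain ⟨k, hk, y, hy, rfl⟩ := hxL
    have hkM : k ∈ M := (mul_mem_cancel_right (hEM hy)).1 hxM
    exact mul_mem (hDE.le ⟨hkM, hk⟩) hy
  rw [height_eq_add_one hD, height_eq_height hMN hKL.le hL D inf_le_right]
  rfl

theorem InvariantBetween.height_top_lt_of_lt [Finite G] [Fact p.Prime] [N.Normal] [M.Normal]
    (hNM : N ≤ M) (hMN : ∀ m ∈ M, ∃ k, m ^ p ^ k ∈ N) {K L : Subgroup G} (hKL : K < L)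
    (hNK : N ≤ K) (hNL : N ≤ L) (hKM : K ⊔ M = ⊤) :
    Order.height (top (M := M) hNM hNK) + 1 ≤ Order.height (top (M := M) hNM hNL) := by
  induction L using WellFoundedLT.induction with
  | ind L ih =>
    obtain ⟨J, hKJ, hJL⟩ := exists_le_covBy_of_lt hKL
    have hNJ := hNK.trans hKJ
    rw [height_top_of_covBy hNM hMN hJL hNJ hNL
      (top_le_iff.1 (hKM.ge.trans (sup_le_sup_right hKJ M)))]
    refine add_le_add_left ?_ 1
    rcases hKJ.eq_or_lt with rfl | hlt
    · exact le_rfl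
    · exact le_self_add.trans (ih J hJL.lt hlt hNJ)

end InvariantBetween

end Subgroup

/-- **Theorem 1.5.** Let `G` be a finite solvable group with isomorphic subgroups `H` and `K`,
where `H` is maximal in `G` (so `|G : H| = p ^ n` for a prime `p` and a positive integer `n`).
If the `p`-length of `G` is at most `1`, i.e. there are normal subgroups `N ≤ M` of `G` with
`N` a `p'`-group, `M / N` a `p`-group and `G / M` a `p'`-group, then `K` is also maximal. -/
theorem maximal_of_p_length_le_one
    (G : Type) [Group G] [Finite G] (hG : IsSolvable G)
    (H K : Subgroup G) (hiso : Nonempty (H ≃* K)) (hH : IsCoatom H)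
    (p n : ℕ) (hp : p.Prime) (hn : 0 < n) (hidx : H.index = p ^ n)
    (hlen : ∃ (N M : Subgroup G) (_ : N.Normal) (_ : M.Normal), N ≤ M ∧
      (Nat.card N).Coprime p ∧
      IsPGroup p (M ⧸ N.subgroupOf M) ∧
      (Nat.card (G ⧸ M)).Coprime p) :
    IsCoatom K := by
  have := Fact.mk hp
  obtain ⟨e⟩ := hiso
  obtain ⟨N, M, hN, hM, hNM, hNp, hMN, hMp⟩ := hlen
  replace hMN : ∀ m ∈ M, ∃ k, m ^ p ^ k ∈ N := fun m hm => by
    obtain ⟨k, hk⟩ := hMN (QuotientGroup.mk ⟨m, hm⟩)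
    refine ⟨k, ?_⟩
    rw [← QuotientGroup.mk_pow, QuotientGroup.eq_one_iff] at hk
    exact hk
  rw [← Subgroup.index_eq_card] at hMp
  have hidxK : K.index = p ^ n := by
    have h := (Subgroup.card_mul_index H).trans (Subgroup.card_mul_index K).symm
    rw [Nat.card_congr e.toEquiv] at h
    exact (Nat.eq_of_mul_eq_mul_left Nat.card_pos h).symm.trans hidx
  have hNH : N ≤ H := Subgroup.le_of_coprime_index (hidx ▸ hNp.pow_right n)
  have hNK : N ≤ K := Subgroup.le_of_coprime_index (hidxK ▸ hNp.pow_right n)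
  have hHM : H ⊔ M = ⊤ := Subgroup.sup_eq_top_of_coprime_index (hidx ▸ hMp.pow_right n)
  have hKM : K ⊔ M = ⊤ := Subgroup.sup_eq_top_of_coprime_index (hidxK ▸ hMp.pow_right n)
  have hNT : N ≤ ⊤ := le_top
  have h₁ := Subgroup.InvariantBetween.height_top_of_covBy hNM hMN hH.covBy_top hNH hNT hHM
  have h₂ := Subgroup.InvariantBetween.height_top_le_of_mulEquiv hNM hNp hMp hMN hNH hNK e
  refine ⟨fun h => ?_, fun L hKL => ?_⟩
  · rw [h, Subgroup.index_top] at hidxK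
    exact (Nat.one_lt_pow hn.ne' hp.one_lt).ne hidxK
  · by_contra hL
    have hNL := hNK.trans hKL.le
    have hLM : L ⊔ M = ⊤ := top_le_iff.1 (hKM.ge.trans (sup_le_sup_right hKL.le M))
    have h₃ := Subgroup.InvariantBetween.height_top_lt_of_lt hNM hMN hKL hNK hNL hKM
    have h₄ := Subgroup.InvariantBetween.height_top_lt_of_lt hNM hMN (lt_top_iff_ne_top.2 hL) hNL hNT hLM
    have hle := (add_le_add_left h₃ 1).trans (h₄.trans (h₁.le.trans (add_le_add_left h₂ 1)))
    have hfin := Order.height_ne_top_of_finite (Subgroup.InvariantBetween.top (M := M) hNM hNK)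
    lift Order.height (Subgroup.InvariantBetween.top (M := M) hNM hNK) to ℕ using hfin with a
    norm_cast at hle
    omega
end

section
/- Let G be a finite solvable group, let p be a prime, and let H be a subgroup of G whose index |G : H| is a power of p. Then O_p(G) ∩ H = O_p(H). (Lemma 2.1) -/
/-- `O_p(G)`: the `p`-core of `G`, i.e. the largest normal `p`-subgroup of `G`
(for finite `G` the join of all normal `p`-subgroups is the largest one). -/
def pCore (p : ℕ) (G : Type*) [Group G] : Subgroup G :=
  sSup {N : Subgroup G | N.Normal ∧ IsPGroup p N}

section PCore

variable {G : Type*} [Group G] {p : ℕ}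

lemma le_pCore {N : Subgroup G} [hN : N.Normal] (h : IsPGroup p N) : N ≤ pCore p G :=
  le_sSup ⟨hN, h⟩

lemma pCore_normal_and_isPGroup [Finite G] : (pCore p G).Normal ∧ IsPGroup p (pCore p G) := by
  obtain ⟨M, hM⟩ := (Set.toFinite {N : Subgroup G | N.Normal ∧ IsPGroup p N}).exists_maximal
    ⟨⊥, inferInstance, IsPGroup.of_bot⟩
  have hMn := hM.prop.1
  have hMp := hM.prop.2
  have h : pCore p G = M := by
    refine le_antisymm (sSup_le fun K hK ↦ ?_) (le_pCore hMp)
    have hKn := hK.1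
    exact le_sup_left.trans (hM.le_of_ge
      ⟨inferInstance, hK.2.to_sup_of_normal_right hMp⟩ le_sup_right)
  rw [h]
  exact hM.prop

instance pCore_normal [Finite G] : (pCore p G).Normal := pCore_normal_and_isPGroup.1

lemma isPGroup_pCore [Finite G] : IsPGroup p (pCore p G) := pCore_normal_and_isPGroup.2

lemma pCore_quotient_pCore [Finite G] : pCore p (G ⧸ pCore p G) = ⊥ := by
  have h : (pCore p (G ⧸ pCore p G)).comap (QuotientGroup.mk' (pCore p G)) ≤ pCore p G := by
    refine le_pCore (isPGroup_pCore.comap_of_ker_isPGroup _ ?_)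
    rw [QuotientGroup.ker_mk']
    exact isPGroup_pCore
  rw [eq_bot_iff, ← Subgroup.map_comap_eq_self_of_surjective
    (QuotientGroup.mk'_surjective (pCore p G)) (pCore p (G ⧸ pCore p G)), Subgroup.map_le_iff_le_comap,
    MonoidHom.comap_bot, QuotientGroup.ker_mk']
  exact h

end PCore

namespace Subgroup

variable {G : Type*} [Group G] [Finite G]

lemma card_inf_mul_relIndex_sup (H N : Subgroup G) [N.Normal] :
    Nat.card (N ⊓ H : Subgroup G) * H.relIndex (H ⊔ N) = Nat.card N := by
  have h1 : Nat.card N * N.relIndex H = Nat.card (H ⊔ N : Subgroup G) := by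
    rw [← relIndex_sup_right H N, ← relIndex_bot_left, ← relIndex_bot_left,
      relIndex_mul_relIndex _ _ _ bot_le le_sup_right]
  have h2 : Nat.card H * H.relIndex (H ⊔ N) = Nat.card (H ⊔ N : Subgroup G) := by
    rw [← relIndex_bot_left, ← relIndex_bot_left,
      relIndex_mul_relIndex _ _ _ bot_le le_sup_left]
  have h3 : Nat.card (N ⊓ H : Subgroup G) * N.relIndex H = Nat.card H := by
    rw [← inf_relIndex_right N H, ← relIndex_bot_left, ← relIndex_bot_left,
      relIndex_mul_relIndex _ _ _ bot_le inf_le_right]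
  have h4 : 0 < N.relIndex H := Nat.pos_of_ne_zero index_ne_zero_of_finite
  rw [← h3] at h2
  refine Nat.eq_of_mul_eq_mul_right h4 ?_
  rw [h1, ← h2]
  ring

lemma card_sup_dvd_mul (H N : Subgroup G) [N.Normal] :
    Nat.card (H ⊔ N : Subgroup G) ∣ Nat.card H * Nat.card N := by
  rw [← card_inf_mul_relIndex_sup H N]
  refine ⟨Nat.card (N ⊓ H : Subgroup G), ?_⟩
  rw [← relIndex_bot_left (H ⊔ N), ← relIndex_mul_relIndex ⊥ H (H ⊔ N) bot_le le_sup_left,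
    relIndex_bot_left]
  ring

lemma le_of_index_eq_prime_pow {p n : ℕ} (hp : p.Prime) {H N : Subgroup G} [N.Normal]
    (hH : H.index = p ^ n) (hN : ¬ p ∣ Nat.card N) : N ≤ H := by
  have h1 : H.relIndex (H ⊔ N) ∣ p ^ n := hH ▸ relIndex_dvd_index_of_le le_sup_left
  have h2 : H.relIndex (H ⊔ N) ∣ Nat.card N := Dvd.intro_left _ (card_inf_mul_relIndex_sup H N)
  have h3 : H.relIndex (H ⊔ N) = 1 :=
    Nat.eq_one_of_dvd_coprimes (((Nat.Prime.coprime_iff_not_dvd hp).2 hN).pow_left n) h1 h2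
  exact le_sup_right.trans (relIndex_eq_one.1 h3)

variable {p : ℕ}

lemma not_dvd_card_of_commutator_le_centralizer (hp : p.Prime) (hG : pCore p G = ⊥)
    {A : Subgroup G} [A.Normal] (hA : ⁅A, A⁆ ≤ centralizer A) : ¬ p ∣ Nat.card A := by
  have : Fact p.Prime := ⟨hp⟩
  have hker : (Abelianization.of (G := A)).ker ≤ center A := by
    rw [Abelianization.ker_of]
    intro x hx
    have hx' : (x : G) ∈ ⁅A, A⁆ := by
      rw [← map_subtype_commutator]
      exact mem_map_of_mem _ hx
    rw [mem_center_iff]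
    intro g
    exact Subtype.ext (mem_centralizer_iff.1 (hA hx') g g.2)
  have : Group.IsNilpotent A := isNilpotent_of_ker_le_center _ hker
  let P : Sylow p A := default
  have hPn : (P : Subgroup A).Normal := inferInstance
  have hPc : (P : Subgroup A).Characteristic := P.characteristic_of_normal hPn
  have hP : (P : Subgroup A).map A.subtype ≤ ⊥ := hG ▸ le_pCore (P.isPGroup'.map A.subtype)
  have hP' : (P : Subgroup A) = ⊥ :=
    (map_eq_bot_iff_of_injective _ A.subtype_injective).1 (le_bot_iff.1 hP)
  have := P.not_dvd_index
  rwa [hP', index_bot] at this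

/-- A `p`-constraint property of solvable groups with trivial `p`-core. -/
lemma exists_normal_centralizer_le [Group.IsSolvable G] (hp : p.Prime) (hG : pCore p G = ⊥) :
    ∃ N : Subgroup G, N.Normal ∧ ¬ p ∣ Nat.card N ∧ centralizer (N : Set G) ≤ N := by
  obtain ⟨N, hN⟩ := (Set.toFinite {N : Subgroup G | N.Normal ∧ ¬ p ∣ Nat.card N}).exists_maximal
    ⟨⊥, inferInstance, by simpa using hp.one_lt.ne'⟩
  have hNn := hN.prop.1
  refine ⟨N, hN.prop.1, hN.prop.2, ?_⟩
  have step (A : Subgroup G) [A.Normal] (hAC : A ≤ centralizer N) (hA : ⁅A, A⁆ ≤ N) : A ≤ N := by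
    have hAp := not_dvd_card_of_commutator_le_centralizer hp hG
      (hA.trans (le_centralizer_iff.1 hAC))
    refine le_sup_left.trans (hN.le_of_ge ⟨inferInstance, fun h ↦ ?_⟩ le_sup_right)
    exact (hp.dvd_mul.1 (h.trans (card_sup_dvd_mul A N))).elim hAp hN.prop.2
  have descend (k : ℕ) (hk : centralizer N ⊓ derivedSeries G k ≤ N) : centralizer N ≤ N := by
    induction k with
    | zero => simpa using hk
    | succ k ih =>
      have := derivedSeries_normal G k
      refine ih (step _ inf_le_left (le_trans (le_inf ?_ ?_) hk))
      · exact (commutator_le_left _ _).trans inf_le_left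
      · exact commutator_mono inf_le_right inf_le_right
  obtain ⟨n, hn⟩ := (Group.isSolvable_def G).1 ‹_›
  exact descend n (by simp [hn])

lemma eq_bot_of_isPGroup_of_le_normalizer [Group.IsSolvable G] (hp : p.Prime) (hG : pCore p G = ⊥)
    {H P : Subgroup G} {n : ℕ} (hH : H.index = p ^ n) (hP : IsPGroup p P)
    (hHP : H ≤ normalizer (P : Set G)) : P = ⊥ := by
  have : Fact p.Prime := ⟨hp⟩
  obtain ⟨N, hN, hNp, hNC⟩ := exists_normal_centralizer_le hp hG
  have hNH : N ≤ H := le_of_index_eq_prime_pow hp hH hNp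
  obtain ⟨m, hm⟩ := IsPGroup.iff_card.1 hP
  have hdisj : P ⊓ N = ⊥ := disjoint_iff.1 <| disjoint_of_coprime_natCard <| by
    rw [hm]
    exact ((Nat.Prime.coprime_iff_not_dvd hp).2 hNp).pow_left m
  have hPC : P ≤ centralizer N := by
    rw [← commutator_eq_bot_iff_le_centralizer, eq_bot_iff, ← hdisj, commutator_le]
    refine fun x hx y hy ↦ ⟨?_, ?_⟩
    · rw [commutatorElement_def, mul_assoc, mul_assoc, ← mul_assoc y]
      exact P.mul_mem hx ((mem_normalizer_iff.1 (hHP (hNH hy)) _).1 (P.inv_mem hx))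
    · rw [commutatorElement_def]
      exact N.mul_mem (hN.conj_mem y hy x) (N.inv_mem hy)
  rw [← hdisj, left_eq_inf]
  exact hPC.trans hNC

end Subgroup

/-- **Lemma 2.1.** Let `G` be a finite solvable group, `p` a prime, and `H ≤ G` with
`|G : H|` a power of `p`.  Then `O_p(G) ∩ H = O_p(H)`. -/
theorem pCore_inf_eq_pCore
    (G : Type) [Group G] [Finite G] (hG : IsSolvable G)
    (p : ℕ) (hp : p.Prime)
    (H : Subgroup G) (hidx : ∃ n : ℕ, H.index = p ^ n) :
    pCore p G ⊓ H = (pCore p H).map H.subtype := by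
  refine le_antisymm ?_ (le_inf ?_ (Subgroup.map_subtype_le _))
  · rw [← Subgroup.subgroupOf_map_subtype]
    exact Subgroup.map_mono (le_pCore isPGroup_pCore.comap_subtype)
  · obtain ⟨n, hn⟩ := hidx
    let π := QuotientGroup.mk' (pCore p G)
    have : Group.IsSolvable G := hG
    have := Group.isSolvable_of_surjective (QuotientGroup.mk'_surjective (pCore p G))
    have hidx' : (H.map π).index ∣ p ^ n :=
      hn ▸ H.index_map_dvd (QuotientGroup.mk'_surjective _)
    obtain ⟨m, -, hm⟩ := (Nat.dvd_prime_pow hp).1 hidx'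
    have hbot : ((pCore p H).map H.subtype).map π = ⊥ := by
      refine Subgroup.eq_bot_of_isPGroup_of_le_normalizer hp pCore_quotient_pCore hm
        ((isPGroup_pCore.map _).map _) ?_
      have hle : H ≤ Subgroup.normalizer ((pCore p H).map H.subtype : Set G) := by
        have := Subgroup.le_normalizer_map (H := pCore p H) H.subtype
        rwa [Subgroup.normalizer_eq_top, ← MonoidHom.range_eq_map, H.range_subtype] at this
      exact (Subgroup.map_mono hle).trans (Subgroup.le_normalizer_map π)
    rw [← QuotientGroup.ker_mk' (pCore p G)]
    exact (Subgroup.map_eq_bot_iff _).1 hbot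
end
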